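/- Let k be a field of characteristic 0 with algebraic closure L, let f_1,…,f_l ∈ k[U,X], and let E, N be finite subsets of k[U] such that for all ū ∈ V_L(E)∖V_L(N): I(ū) is zero-dimensional and the number of points of V_L(I(ū)) equals a fixed integer k_0. Then there exists a finite set {(E_1,N_1,t_1,d_1),…,(E_s,N_s,t_s,d_s)} with E_i, N_i finite subsets of k[U], t_i ∈ k[X], and d_i ∈ k[U][T], such that V_L(E)∖V_L(N) = ⋃_{i=1}^{s} V_L(E_i)∖V_L(N_i), and for each i and every ū ∈ V_L(E_i)∖V_L(N_i): t_i separates V_L(I(ū)), and d_i(ū,T) is a greatest common divisor in L[T] of χ_i(ū) and its derivative χ_i(ū)′, where χ_i(ū) ∈ L[T] is the characteristic polynomial of the multiplication map by t_i on L[X]/I(ū). -/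

import Mathlib

/-- The specialized ideal `I(u) = ⟨f_1(u,X),…,f_l(u,X)⟩ ⊆ L[X]` obtained from
`f_1,…,f_l ∈ k[U,X]` by substituting `u ∈ L^m` for the parameters `U`. -/
noncomputable def specIdeal (k L : Type) [Field k] [Field L] [Algebra k L]
    {m n l : ℕ} (f : Fin l → MvPolynomial (Fin m ⊕ Fin n) k) (u : Fin m → L) :
    Ideal (MvPolynomial (Fin n) L) :=
  Ideal.span (Set.range fun j : Fin l =>
    MvPolynomial.aeval (Sum.elim (fun i => MvPolynomial.C (u i)) MvPolynomial.X) (f j))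


namespace Stmt14Aux

open MvPolynomial
open scoped TensorProduct

section
attribute [local instance] MvPolynomial.algebraMvPolynomial

theorem gfree {n : ℕ} {B : Type} [CommRing B] [IsDomain B] (I : Ideal (MvPolynomial (Fin n) B)) :
    ∃ g : B, g ≠ 0 ∧ ∀ (S : Type) [CommRing S] [Algebra B S] [IsLocalization.Away g S],
      Module.Free S (MvPolynomial (Fin n) S ⧸
        I.map (MvPolynomial.map (σ := Fin n) (algebraMap B S))) := by
  classical
  let m : MonomialOrder (Fin n) := MonomialOrder.lex
  let D : Set (Fin n →₀ ℕ) := {d | ∃ b ∈ I, b ≠ 0 ∧ m.degree b = d}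
  have hmin : ∃ M : Finset (Fin n →₀ ℕ), (∀ d ∈ M, d ∈ D) ∧ ∀ d ∈ D, ∃ e ∈ M, e ≤ d := by
    have hfin : {d | Minimal (· ∈ D) d}.Finite := by
      apply (setOfPred_minimal_antichain _).finite_of_partiallyWellOrderedOn
      exact Set.isPWO_of_wellQuasiOrderedLE _
    refine ⟨hfin.toFinset, ?_, ?_⟩
    · intro d hd
      simp at hd
      exact hd.1
    · intro d hd
      obtain ⟨e, he, h⟩ := exists_minimal_le_of_wellFoundedLT (· ∈ D) d hd
      exact ⟨e, by simpa using h, he⟩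
  obtain ⟨M, hM, hMD⟩ := hmin
  choose! b hbI hb0 hbd using hM
  let g : B := ∏ d ∈ M, m.leadingCoeff (b d)
  have hg : g ≠ 0 := Finset.prod_ne_zero_iff.mpr fun d hd => m.leadingCoeff_ne_zero_iff.mpr (hb0 d hd)
  refine ⟨g, hg, ?_⟩
  intro S _ _ _
  have hinj : Function.Injective (algebraMap B S) :=
    IsLocalization.injective S (powers_le_nonZeroDivisors_of_noZeroDivisors hg)
  let φ : MvPolynomial (Fin n) B →+* MvPolynomial (Fin n) S := MvPolynomial.map (algebraMap B S)
  have hφinj : Function.Injective φ := MvPolynomial.map_injective _ hinj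
  have hsupp : ∀ x, (φ x).support = x.support := fun x => MvPolynomial.support_map_of_injective x hinj
  have hdeg : ∀ x, m.degree (φ x) = m.degree x := by
    intro x
    simp only [MonomialOrder.degree, hsupp]
  let J : Ideal (MvPolynomial (Fin n) S) := I.map φ
  let T : Set (Fin n →₀ ℕ) := {c | ∀ d ∈ M, ¬ d ≤ c}
  have hu : ∀ d : M, IsUnit (m.leadingCoeff (φ (b d))) := by
    intro d
    have h1 : m.leadingCoeff (φ (b d)) = algebraMap B S (m.leadingCoeff (b d)) := by
      simp only [MonomialOrder.leadingCoeff, hdeg]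
      exact MvPolynomial.coeff_map _ _ _
    rw [h1]
    have h2 : IsUnit (algebraMap B S g) := IsLocalization.Away.algebraMap_isUnit g
    refine isUnit_of_dvd_unit (map_dvd _ ?_) h2
    exact Finset.dvd_prod_of_mem (fun d => m.leadingCoeff (b d)) d.2
  have hcompl : IsCompl (J.restrictScalars S) (MvPolynomial.restrictSupport S T) := by
    constructor
    · rw [Submodule.disjoint_def]
      intro r hrJ hrT
      by_contra hr0
      have hloc := MvPolynomial.isLocalization (σ := Fin n) (R := B) (S := S) (Submonoid.powers g)
      have hrJ' : r ∈ I.map (algebraMap (MvPolynomial (Fin n) B) (MvPolynomial (Fin n) S)) := hrJ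
      rw [IsLocalization.mem_map_algebraMap_iff ((Submonoid.powers g).map (C (σ := Fin n)))] at hrJ'
      obtain ⟨⟨x, s⟩, hx⟩ := hrJ'
      obtain ⟨s, s', hs', hss⟩ := s
      simp only at hx
      obtain ⟨N, rfl⟩ := hs'
      have hx' : C (algebraMap B S (g ^ N)) * r = φ x := by
        have h2 : r * φ s = φ x := hx
        rw [← h2, ← hss, mul_comm]
        congr 1
        exact (MvPolynomial.map_C _ _).symm
      have hsuppx : (x : MvPolynomial (Fin n) B).support ⊆ r.support := by
        rw [← hsupp, ← hx', ← MvPolynomial.smul_eq_C_mul]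
        exact MvPolynomial.support_smul
      have hx0 : (x : MvPolynomial (Fin n) B) ≠ 0 := by
        intro h0
        rw [h0, map_zero] at hx'
        have hunit : IsUnit (algebraMap B S (g ^ N)) := by
          rw [map_pow]
          exact (IsLocalization.Away.algebraMap_isUnit g).pow N
        exact hr0 (((hunit.map (C (σ := Fin n))).mul_right_eq_zero).1 hx')
      obtain ⟨e, heM, hle⟩ := hMD (m.degree (x : MvPolynomial (Fin n) B)) ⟨x, x.2, hx0, rfl⟩
      rw [MvPolynomial.mem_restrictSupport_iff] at hrT
      exact hrT (hsuppx (m.degree_mem_support hx0)) e heM hle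
    · rw [codisjoint_iff, eq_top_iff]
      intro p _
      obtain ⟨q, r, hp, -, hr⟩ := m.div hu p
      rw [hp]
      refine Submodule.add_mem_sup ?_ ?_
      · rw [Submodule.restrictScalars_mem, Finsupp.linearCombination_apply]
        refine Ideal.sum_mem _ fun d _ => ?_
        exact J.mul_mem_left _ (Ideal.mem_map_of_mem φ (hbI d d.2))
      · rw [MvPolynomial.mem_restrictSupport_iff]
        intro c hc d hd
        have := hr c hc ⟨d, hd⟩
        rwa [hdeg, hbd d hd] at this
  have e1 := Submodule.quotientEquivOfIsCompl _ _ hcompl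
  have e2 := Submodule.Quotient.restrictScalarsEquiv S J
  have : Module.Free S (MvPolynomial.restrictSupport S T) := .of_basis (basisRestrictSupport S T)
  exact Module.Free.of_equiv (e1.symm.trans e2)

end

/-- clearing denominators for a finite family of polynomials -/
theorem clearDen {B : Type} [CommRing B] (M : Submonoid B) (K : Type) [CommRing K] [Algebra B K]
    [IsLocalization M K] {ι : Type} [Finite ι] (p : ι → Polynomial K) :
    ∃ s : B, s ∈ M ∧ ∃ q : ι → Polynomial B, ∀ i,
      (q i).map (algebraMap B K) = Polynomial.C (algebraMap B K s) * p i := by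
  classical
  cases nonempty_fintype ι
  have h : ∀ i, ∃ s : M, ∃ q : Polynomial B,
      q.map (algebraMap B K) = Polynomial.C (algebraMap B K s) * p i := by
    intro i
    obtain ⟨b, hbM, hb⟩ := IsLocalization.integerNormalization_spec M (p i)
    refine ⟨⟨b, hbM⟩, _, hb.trans ?_⟩
    rw [Algebra.smul_def, IsScalarTower.algebraMap_apply B K (Polynomial K)]
    rfl
  choose s q hq using h
  refine ⟨∏ i, (s i : B), Submonoid.prod_mem _ fun i _ => (s i).2,
    fun i => Polynomial.C (∏ j ∈ Finset.univ.erase i, (s j : B)) * q i, fun i => ?_⟩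
  rw [Polynomial.map_mul, hq, Polynomial.map_C, ← mul_assoc, ← Polynomial.C_mul, ← map_mul,
    Finset.prod_erase_mul _ _ (Finset.mem_univ i)]

theorem genGcd {S : Type} [CommRing S] [IsDomain S] (χ : Polynomial S) (hχ : χ ≠ 0) :
    ∃ (s : S) (d : Polynomial S), s ≠ 0 ∧ ∀ (L : Type) [Field L] (φ : S →+* L), φ s ≠ 0 →
      (d.map φ).natDegree = d.natDegree ∧ d.map φ ∣ χ.map φ ∧
      d.map φ ∣ (χ.map φ).derivative ∧
      ∀ e, e ∣ χ.map φ → e ∣ (χ.map φ).derivative → e ∣ d.map φ := by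
  classical
  let K := FractionRing S
  let ψ := algebraMap S K
  have hψ : Function.Injective ψ := IsFractionRing.injective S K
  let P := χ.map ψ
  have hP : P ≠ 0 := (Polynomial.map_ne_zero_iff hψ).2 hχ
  let P' := P.derivative
  let d0 := EuclideanDomain.gcd P P'
  obtain ⟨q0, hq0⟩ : d0 ∣ P := EuclideanDomain.gcd_dvd_left _ _
  obtain ⟨r0, hr0⟩ : d0 ∣ P' := EuclideanDomain.gcd_dvd_right _ _
  have hbez : d0 = P * EuclideanDomain.gcdA P P' + P' * EuclideanDomain.gcdB P P' :=
    EuclideanDomain.gcd_eq_gcd_ab _ _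
  have hd0 : d0 ≠ 0 := fun h => hP (by rw [hq0, h, zero_mul])
  obtain ⟨s, hs, p, hp⟩ := clearDen (nonZeroDivisors S) K
    ![d0, q0, r0, EuclideanDomain.gcdA P P', EuclideanDomain.gcdB P P']
  have hs0 : s ≠ 0 := nonZeroDivisors.ne_zero hs
  have e0 := hp 0
  have e1 := hp 1
  have e2 := hp 2
  have e3 := hp 3
  have e4 := hp 4
  simp only [Matrix.cons_val] at e0 e1 e2 e3 e4
  have hψs : ψ s ≠ 0 := by simpa using (map_ne_zero_iff ψ hψ).2 hs0
  have hd : p 0 ≠ 0 := by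
    intro h
    rw [h, Polynomial.map_zero] at e0
    exact mul_ne_zero (Polynomial.C_ne_zero.2 hψs) hd0 e0.symm
  have hmapinj := Polynomial.map_injective ψ hψ
  have i1 : p 0 * p 1 = Polynomial.C (s * s) * χ := by
    apply hmapinj
    rw [Polynomial.map_mul, Polynomial.map_mul, e0, e1, Polynomial.map_C, map_mul, Polynomial.C_mul]
    change _ = _ * P
    rw [hq0]; ring
  have i2 : p 0 * p 2 = Polynomial.C (s * s) * χ.derivative := by
    apply hmapinj
    rw [Polynomial.map_mul, Polynomial.map_mul, e0, e2, Polynomial.map_C, map_mul, Polynomial.C_mul,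
      ← Polynomial.derivative_map]
    change _ = _ * P'
    rw [hr0]; ring
  have i3 : p 0 = χ * p 3 + χ.derivative * p 4 := by
    apply hmapinj
    rw [Polynomial.map_add, Polynomial.map_mul, Polynomial.map_mul, e0, e3, e4,
      ← Polynomial.derivative_map]
    change _ = P * _ + P' * _
    rw [hbez]; ring
  refine ⟨s * (p 0).leadingCoeff, p 0, mul_ne_zero hs0 (Polynomial.leadingCoeff_ne_zero.2 hd), ?_⟩
  intro L _ φ hφ
  rw [map_mul] at hφ
  have hφs := left_ne_zero_of_mul hφ
  have hu : IsUnit (Polynomial.C (φ (s * s))) :=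
    Polynomial.isUnit_C.2 (isUnit_iff_ne_zero.2 (by rw [map_mul]; exact mul_ne_zero hφs hφs))
  refine ⟨Polynomial.natDegree_map_of_leadingCoeff_ne_zero _ (right_ne_zero_of_mul hφ), ?_, ?_, ?_⟩
  · rw [← hu.dvd_mul_left, ← Polynomial.map_C, ← Polynomial.map_mul, ← i1, Polynomial.map_mul]
    exact dvd_mul_right _ _
  · rw [Polynomial.derivative_map, ← hu.dvd_mul_left, ← Polynomial.map_C, ← Polynomial.map_mul, ← i2, Polynomial.map_mul]
    exact dvd_mul_right _ _
  · intro e h1 h2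
    rw [i3, Polynomial.map_add, Polynomial.map_mul, Polynomial.map_mul, ← Polynomial.derivative_map]
    exact dvd_add (h1.mul_right _) (h2.mul_right _)

theorem rootsCount {L : Type} [Field L] [CharZero L] [IsAlgClosed L] (χ d : Polynomial L)
    (hχ : χ ≠ 0) (h1 : d ∣ χ) (h2 : d ∣ χ.derivative)
    (h3 : ∀ e, e ∣ χ → e ∣ χ.derivative → e ∣ d) :
    d.natDegree + {x | χ.IsRoot x}.ncard = χ.natDegree := by
  classical
  have hd : d ≠ 0 := fun h => hχ (zero_dvd_iff.1 (h ▸ h1))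
  have hset : {x | χ.IsRoot x} = (χ.roots.toFinset : Set L) := by
    ext x; simp [hχ]
  have key : d.roots + χ.roots.toFinset.val = χ.roots := by
    ext x
    rw [Multiset.count_add, Polynomial.count_roots, Polynomial.count_roots]
    by_cases hx : χ.IsRoot x
    · have hc : Multiset.count x χ.roots.toFinset.val = 1 := by
        apply Multiset.count_eq_one_of_mem (Finset.nodup _)
        simpa [hχ] using hx
      rw [hc]
      have hpos : 0 < χ.rootMultiplicity x := (Polynomial.rootMultiplicity_pos hχ).2 hx
      have hder := Polynomial.derivative_rootMultiplicity_of_root hx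
      have hχ' : χ.derivative ≠ 0 := by
        intro h0
        have := Polynomial.derivative_eq_zero.1 h0
        rw [Polynomial.eq_C_of_natDegree_eq_zero this] at hx hχ
        simp at hx hχ
        exact hχ hx
      have hle1 := (Polynomial.rootMultiplicity_le_rootMultiplicity_of_dvd hχ' h2 x)
      have hle2 : χ.rootMultiplicity x - 1 ≤ d.rootMultiplicity x := by
        rw [Polynomial.le_rootMultiplicity_iff hd]
        apply h3
        · exact (pow_dvd_pow _ (Nat.sub_le _ _)).trans (Polynomial.pow_rootMultiplicity_dvd _ _)
        · rw [← hder]; exact Polynomial.pow_rootMultiplicity_dvd _ _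
      omega
    · have hc : Multiset.count x χ.roots.toFinset.val = 0 := by
        apply Multiset.count_eq_zero_of_notMem
        simpa [hχ] using hx
      have hle := (Polynomial.rootMultiplicity_le_rootMultiplicity_of_dvd hχ h1 x)
      have := Polynomial.rootMultiplicity_eq_zero hx
      omega
  have hcard := congrArg Multiset.card key
  rw [Multiset.card_add, IsAlgClosed.card_roots_eq_natDegree, IsAlgClosed.card_roots_eq_natDegree] at hcard
  rw [hset, Set.ncard_coe_finset]
  exact hcard

/-- roots of the characteristic polynomial of a multiplication map are the values on the variety. -/
theorem rootsCharpoly {L : Type} [Field L] [IsAlgClosed L] {n : ℕ}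
    (I : Ideal (MvPolynomial (Fin n) L)) [FiniteDimensional L (MvPolynomial (Fin n) L ⧸ I)]
    (t : MvPolynomial (Fin n) L) :
    {x | (LinearMap.charpoly (LinearMap.mulLeft L (Ideal.Quotient.mk I t))).IsRoot x} =
      (fun q : Fin n → L => aeval q t) '' {q | ∀ g ∈ I, aeval q g = 0} := by
  ext x
  simp only [Set.mem_ofPred_eq, Set.mem_image]
  rw [← Module.End.hasEigenvalue_iff_isRoot_charpoly]
  constructor
  · intro h
    obtain ⟨v, hv⟩ := h.exists_hasEigenvector
    obtain ⟨hv1, hv0⟩ := hv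
    rw [Module.End.mem_eigenspace_iff] at hv1
    have hne : I ⊔ Ideal.span {t - C x} ≠ ⊤ := by
      intro htop
      rw [Ideal.eq_top_iff_one, Submodule.mem_sup] at htop
      obtain ⟨a, ha, b, hb, hab⟩ := htop
      rw [Ideal.mem_span_singleton'] at hb
      obtain ⟨c, rfl⟩ := hb
      have : (Ideal.Quotient.mk I c) * (Ideal.Quotient.mk I (t - C x)) = 1 := by
        rw [← map_mul, ← map_one (Ideal.Quotient.mk I), ← hab, map_add,
          Ideal.Quotient.eq_zero_iff_mem.2 ha, zero_add]
      apply hv0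
      have h0 : Ideal.Quotient.mk I (t - C x) * v = 0 := by
        rw [map_sub, sub_mul, sub_eq_zero]
        rw [LinearMap.mulLeft_apply] at hv1
        rw [hv1]
        obtain ⟨p, rfl⟩ := Ideal.Quotient.mk_surjective v
        rw [← map_mul, ← MvPolynomial.smul_eq_C_mul]
        rfl
      rw [← one_mul v, ← this, mul_assoc, h0, mul_zero]
    obtain ⟨Mx, hMx, hle⟩ := Ideal.exists_le_maximal _ hne
    obtain ⟨q, hq⟩ := MvPolynomial.isMaximal_iff_eq_vanishingIdeal_singleton.1 hMx
    have hmem : ∀ p ∈ Mx, aeval q p = 0 := by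
      intro p hp
      rw [hq] at hp
      exact (MvPolynomial.mem_vanishingIdeal_singleton_iff q p).1 hp
    refine ⟨q, fun g hg => hmem g (hle (Ideal.mem_sup_left hg)), ?_⟩
    have := hmem _ (hle (Ideal.mem_sup_right (Ideal.mem_span_singleton_self _)))
    rw [map_sub, sub_eq_zero] at this
    simpa using this
  · rintro ⟨q, hq, rfl⟩
    by_contra hne
    have hinj : Function.Injective (LinearMap.mulLeft L (Ideal.Quotient.mk I t) -
        (aeval q t) • (1 : Module.End L (MvPolynomial (Fin n) L ⧸ I))) := by
      rw [← LinearMap.ker_eq_bot, ← Module.End.eigenspace_def]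
      by_contra hh
      exact hne (Module.End.hasEigenvalue_iff.2 hh)
    obtain ⟨v, hv⟩ := LinearMap.surjective_of_injective hinj 1
    obtain ⟨p, rfl⟩ := Ideal.Quotient.mk_surjective v
    have hv' : Ideal.Quotient.mk I ((t - C (aeval q t)) * p) = Ideal.Quotient.mk I 1 := by
      rw [map_one, ← hv, sub_mul, map_sub, map_mul, map_mul]
      rw [← map_mul _ (C _), ← MvPolynomial.smul_eq_C_mul]
      rfl
    have := hq _ (Ideal.Quotient.eq.1 hv')
    simp at this

theorem finVar {L : Type} [Field L] [IsAlgClosed L] {n : ℕ}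
    (I : Ideal (MvPolynomial (Fin n) L)) [FiniteDimensional L (MvPolynomial (Fin n) L ⧸ I)] :
    {q : Fin n → L | ∀ g ∈ I, aeval q g = 0}.Finite := by
  classical
  have h : ∀ i : Fin n, {x | (LinearMap.charpoly (LinearMap.mulLeft L (Ideal.Quotient.mk I (X i)))).IsRoot x}.Finite :=
    fun i => Polynomial.finite_setOfPred_isRoot (LinearMap.charpoly_monic _).ne_zero
  refine (Set.Finite.pi' h).subset ?_
  intro q hq i
  rw [rootsCharpoly]
  exact ⟨q, hq, by simp⟩

/-- separating linear forms from the moment curve -/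
theorem sepForm {L : Type} [Field L] [CharZero L] {n : ℕ} (V : Set (Fin n → L)) (hV : V.Finite) :
    ∃ c : Fin (V.ncard * V.ncard * n + 1), Set.InjOn (fun q : Fin n → L => ∑ i : Fin n, ((c : ℕ) : L) ^ (i : ℕ) * q i) V := by
  classical
  let F := hV.toFinset
  let P : (Fin n → L) × (Fin n → L) → Polynomial L := fun z =>
    ∑ i : Fin n, Polynomial.monomial (i : ℕ) (z.1 i - z.2 i)
  have hPe : ∀ z c, (P z).eval c = ∑ i : Fin n, c ^ (i : ℕ) * z.1 i - ∑ i : Fin n, c ^ (i : ℕ) * z.2 i := by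
    intro z c
    rw [Polynomial.eval_finsetSum, ← Finset.sum_sub_distrib]
    refine Finset.sum_congr rfl fun i _ => ?_
    rw [Polynomial.eval_monomial]; ring
  have hP0 : ∀ z, z.1 ≠ z.2 → P z ≠ 0 := by
    intro z hz h0
    apply hz
    funext i
    have := congrArg (fun p => p.coeff (i : ℕ)) h0
    simp only [P, Polynomial.finsetSum_coeff, Polynomial.coeff_monomial, Polynomial.coeff_zero] at this
    rw [Finset.sum_eq_single i] at this
    · simpa [sub_eq_zero] using this
    · intro j _ hj
      rw [if_neg]
      exact fun h => hj (Fin.ext h)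
    · simp
  have hPd : ∀ z, (P z).natDegree ≤ n := by
    intro z
    refine Polynomial.natDegree_sum_le_of_forall_le _ _ fun i _ => ?_
    exact (Polynomial.natDegree_monomial_le _).trans i.2.le
  let Q := ∏ z ∈ F.offDiag, P z
  have hQ0 : Q ≠ 0 := Finset.prod_ne_zero_iff.2 fun z hz => hP0 z (Finset.mem_offDiag.1 hz).2.2
  have hQd : Q.natDegree ≤ V.ncard * V.ncard * n := by
    refine (Polynomial.natDegree_prod_le _ _).trans ((Finset.sum_le_card_nsmul _ _ n fun z _ => hPd z).trans ?_)
    rw [smul_eq_mul]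
    refine Nat.mul_le_mul_right _ ?_
    rw [Finset.offDiag_card, Set.ncard_eq_toFinset_card V hV]
    exact Nat.sub_le _ _
  have hex : ∃ c : Fin (V.ncard * V.ncard * n + 1), Q.eval ((c : ℕ) : L) ≠ 0 := by
    by_contra! hall
    refine hQ0 (Polynomial.eq_zero_of_natDegree_lt_card_of_eval_eq_zero Q (f := fun c : Fin (V.ncard * V.ncard * n + 1) => ((c : ℕ) : L)) ?_ hall ?_)
    · intro a b hab
      exact Fin.ext (Nat.cast_injective hab)
    · rw [Fintype.card_fin]; omega
  obtain ⟨c, hc⟩ := hex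
  refine ⟨c, fun p hp q hq hpq => ?_⟩
  by_contra hne
  rw [Polynomial.eval_prod, Finset.prod_ne_zero_iff] at hc
  refine hc (p, q) (by simp [F, hp, hq, hne]) ?_
  rw [hPe, sub_eq_zero]
  exact hpq

noncomputable def specEquiv {S L : Type} [CommRing S] [Field L] [Algebra S L] {n : ℕ}
    (J : Ideal (MvPolynomial (Fin n) S)) :
    (L ⊗[S] (MvPolynomial (Fin n) S ⧸ J)) ≃ₐ[L]
      (MvPolynomial (Fin n) L ⧸ J.map (MvPolynomial.map (σ := Fin n) (algebraMap S L))) :=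
  (Algebra.TensorProduct.tensorQuotientEquiv (R := S) L (MvPolynomial (Fin n) S) L J).trans
    (Ideal.quotientEquivAlg _ _ (MvPolynomial.algebraTensorAlgEquiv S L) (by
      refine Eq.trans ?_ (Ideal.map_map (Algebra.TensorProduct.includeRight (R := S) (A := L)
        (B := MvPolynomial (Fin n) S)).toRingHom
        (MvPolynomial.algebraTensorAlgEquiv (σ := Fin n) S L).toRingEquiv.toRingHom).symm
      congr 1
      apply RingHom.ext
      intro x
      simp))

theorem specEquiv_tmul {S L : Type} [CommRing S] [Field L] [Algebra S L] {n : ℕ}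
    (J : Ideal (MvPolynomial (Fin n) S)) (t : MvPolynomial (Fin n) S) :
    specEquiv (L := L) J (1 ⊗ₜ[S] Ideal.Quotient.mk J t) =
      Ideal.Quotient.mk _ (MvPolynomial.map (algebraMap S L) t) := by
  have : specEquiv (L := L) J (1 ⊗ₜ[S] Ideal.Quotient.mk J t) =
     Ideal.Quotient.mk _ (MvPolynomial.algebraTensorAlgEquiv S L (1 ⊗ₜ[S] t)) := rfl
  rw [this]
  simp

theorem spec_finite {S L : Type} [CommRing S] [IsDomain S] [Field L] [Algebra S L] {n : ℕ}
    (J : Ideal (MvPolynomial (Fin n) S)) [Module.Free S (MvPolynomial (Fin n) S ⧸ J)]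
    (hfin : FiniteDimensional L (MvPolynomial (Fin n) L ⧸
      J.map (MvPolynomial.map (σ := Fin n) (algebraMap S L)))) :
    Module.Finite S (MvPolynomial (Fin n) S ⧸ J) := by
  have h : Module.Finite L (L ⊗[S] (MvPolynomial (Fin n) S ⧸ J)) :=
    Module.Finite.equiv (specEquiv (L := L) J).symm.toLinearEquiv
  let b := Module.Free.chooseBasis S (MvPolynomial (Fin n) S ⧸ J)
  let b' := Algebra.TensorProduct.basis L b
  have : Finite (Module.Free.ChooseBasisIndex S (MvPolynomial (Fin n) S ⧸ J)) :=
    Module.Finite.finite_basis b'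
  exact Module.Finite.of_basis b

theorem spec_charpoly {S L : Type} [CommRing S] [Field L] [Algebra S L] {n : ℕ}
    (J : Ideal (MvPolynomial (Fin n) S)) [Module.Free S (MvPolynomial (Fin n) S ⧸ J)]
    [Module.Finite S (MvPolynomial (Fin n) S ⧸ J)]
    (I : Ideal (MvPolynomial (Fin n) L)) 
    (hI : I = J.map (MvPolynomial.map (σ := Fin n) (algebraMap S L)))
    (t : MvPolynomial (Fin n) S) (hfin : FiniteDimensional L (MvPolynomial (Fin n) L ⧸ I)) :
    LinearMap.charpoly (LinearMap.mulLeft L (Ideal.Quotient.mk I (MvPolynomial.map (algebraMap S L) t))) =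
      (LinearMap.charpoly (LinearMap.mulLeft S (Ideal.Quotient.mk J t))).map (algebraMap S L) := by
  subst hI
  rw [← LinearMap.charpoly_baseChange]
  have e := (specEquiv (L := L) J)
  rw [← LinearEquiv.charpoly_conj (specEquiv (L := L) J).toLinearEquiv]
  congr 1
  have h2 : LinearMap.baseChange L (LinearMap.mulLeft S (Ideal.Quotient.mk J t)) = LinearMap.mulLeft L ((1 : L) ⊗ₜ[S] (Ideal.Quotient.mk J t)) :=
    Algebra.baseChange_lmul (R := S) (A := L) (Ideal.Quotient.mk J t)
  rw [h2, ← specEquiv_tmul]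
  apply LinearMap.ext
  intro x
  rw [LinearEquiv.conj_apply_apply, LinearMap.mulLeft_apply, LinearMap.mulLeft_apply]
  change _ = specEquiv J (_ * (specEquiv J).symm x)
  rw [map_mul, AlgEquiv.apply_symm_apply]

noncomputable def polyS {k S : Type} [CommRing k] [CommRing S] {m n : ℕ}
    (ρ : MvPolynomial (Fin m) k →+* S) :
    MvPolynomial (Fin m ⊕ Fin n) k →+* MvPolynomial (Fin n) S :=
  eval₂Hom (C.comp (ρ.comp C)) (Sum.elim (fun i => C (ρ (X i))) X)

theorem polyS_map {k S S' : Type} [CommRing k] [CommRing S] [CommRing S'] {m n : ℕ}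
    (ρ : MvPolynomial (Fin m) k →+* S) (φ : S →+* S') (f : MvPolynomial (Fin m ⊕ Fin n) k) :
    MvPolynomial.map φ (polyS ρ f) = polyS (φ.comp ρ) f := by
  have : (MvPolynomial.map φ).comp (polyS (n := n) ρ) = polyS (φ.comp ρ) := by
    apply MvPolynomial.ringHom_ext
    · intro r; simp [polyS]
    · rintro (i | i) <;> simp [polyS]
  exact congrArg (fun h => h f) this

noncomputable def idS {k S : Type} [CommRing k] [CommRing S] {m n l : ℕ}
    (f : Fin l → MvPolynomial (Fin m ⊕ Fin n) k) (ρ : MvPolynomial (Fin m) k →+* S) :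
    Ideal (MvPolynomial (Fin n) S) := Ideal.span (Set.range fun j => polyS ρ (f j))

theorem idS_map {k S S' : Type} [CommRing k] [CommRing S] [CommRing S'] {m n l : ℕ}
    (f : Fin l → MvPolynomial (Fin m ⊕ Fin n) k)
    (ρ : MvPolynomial (Fin m) k →+* S) (φ : S →+* S') :
    idS f (φ.comp ρ) = (idS f ρ).map (MvPolynomial.map (σ := Fin n) φ) := by
  rw [idS, idS, Ideal.map_span, ← Set.range_comp]
  congr 2
  funext j
  exact (polyS_map ρ φ (f j)).symm

theorem specIdeal_eq {k L : Type} [Field k] [Field L] [Algebra k L] {m n l : ℕ}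
    (f : Fin l → MvPolynomial (Fin m ⊕ Fin n) k) (u : Fin m → L) :
    specIdeal k L f u = idS f (aeval u : MvPolynomial (Fin m) k →ₐ[k] L).toRingHom := by
  rw [specIdeal, idS]
  congr 2
  funext j
  have : (aeval (Sum.elim (fun i => C (u i)) X) :
      MvPolynomial (Fin m ⊕ Fin n) k →ₐ[k] MvPolynomial (Fin n) L).toRingHom =
      polyS (aeval u : MvPolynomial (Fin m) k →ₐ[k] L).toRingHom := by
    apply MvPolynomial.ringHom_ext
    · intro r; simp [polyS, MvPolynomial.algebraMap_eq, IsScalarTower.algebraMap_apply k L (MvPolynomial (Fin n) L)]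
    · rintro (i | i) <;> simp [polyS]
  exact congrArg (fun h => h (f j)) this

def IsGcdDer {L : Type} [Field L] (d χ : Polynomial L) : Prop :=
  d ∣ χ ∧ d ∣ Polynomial.derivative χ ∧
    ∀ e : Polynomial L, e ∣ χ → e ∣ Polynomial.derivative χ → e ∣ d

theorem nullst {k L : Type} [Field k] [Field L] [Algebra k L] [IsAlgClosure k L] {m : ℕ}
    (P : Ideal (MvPolynomial (Fin m) k)) [P.IsPrime] (a : MvPolynomial (Fin m) k) (ha : a ∉ P) :
    ∃ u : Fin m → L, (∀ p ∈ P, aeval u p = 0) ∧ aeval u a ≠ 0 := by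
  have : IsAlgClosed L := IsAlgClosure.isAlgClosed k
  have : Algebra.IsAlgebraic k L := IsAlgClosure.isAlgebraic
  by_contra! h
  apply ha
  rw [← MvPolynomial.IsPrime.vanishingIdeal_zeroLocus (K := L) P]
  intro u hu
  exact h u hu

def Good (k L : Type) [Field k] [Field L] [Algebra k L] {m n l : ℕ}
    (f : Fin l → MvPolynomial (Fin m ⊕ Fin n) k) (t : MvPolynomial (Fin n) k)
    (d : Polynomial (MvPolynomial (Fin m) k)) (u : Fin m → L) : Prop :=
  ∀ _ : FiniteDimensional L (MvPolynomial (Fin n) L ⧸ specIdeal k L f u),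
    Set.InjOn (fun q : Fin n → L => aeval q t)
      {q : Fin n → L | ∀ g ∈ specIdeal k L f u, aeval q g = 0} ∧
    IsGcdDer (d.map (aeval u).toRingHom) (LinearMap.charpoly (LinearMap.mulLeft L
      ((Ideal.Quotient.mk (specIdeal k L f u)) (MvPolynomial.map (algebraMap k L) t))))

theorem key {k L : Type} [Field k] [CharZero k] [Field L] [Algebra k L] [IsAlgClosure k L]
    {m n l : ℕ} (f : Fin l → MvPolynomial (Fin m ⊕ Fin n) k) (k₀ : ℕ)
    (P : Ideal (MvPolynomial (Fin m) k)) [P.IsPrime] (h : MvPolynomial (Fin m) k) (hh : h ∉ P)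
    (hfin : ∀ u : Fin m → L, (∀ p ∈ P, aeval u p = 0) → aeval u h ≠ 0 →
      FiniteDimensional L (MvPolynomial (Fin n) L ⧸ specIdeal k L f u))
    (hcard : ∀ u : Fin m → L, (∀ p ∈ P, aeval u p = 0) → aeval u h ≠ 0 →
      Nat.card {p : Fin n → L | ∀ g ∈ specIdeal k L f u, aeval p g = 0} = k₀) :
    ∃ g : MvPolynomial (Fin m) k, g ∉ P ∧ ∃ t d, ∀ u : Fin m → L, (∀ p ∈ P, aeval u p = 0) →
      aeval u g ≠ 0 → aeval u h ≠ 0 → Good k L f t d u := by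
  classical
  have : IsAlgClosed L := IsAlgClosure.isAlgClosed k
  have : CharZero L := charZero_of_injective_algebraMap (algebraMap k L).injective
  have hPpr : P.IsPrime := inferInstance
  let B := MvPolynomial (Fin m) k ⧸ P
  obtain ⟨g0, hg0, hfree0⟩ := gfree (idS f (Ideal.Quotient.mk P))
  obtain ⟨g1, hg1⟩ := Ideal.Quotient.mk_surjective g0
  have hg1P : g1 ∉ P := fun hc => hg0 (by rw [← hg1]; exact Ideal.Quotient.eq_zero_iff_mem.2 hc)
  obtain ⟨S, iS1, iS2, iS3, iS4⟩ : ∃ (S : Type) (_ : CommRing S) (_ : Algebra B S),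
      IsDomain S ∧ IsLocalization.Away g0 S :=
    ⟨Localization.Away g0, inferInstance, inferInstance,
      IsLocalization.isDomain_localization (powers_le_nonZeroDivisors_of_noZeroDivisors hg0),
      inferInstance⟩
  have hfree1 := hfree0 S
  rw [← idS_map] at hfree1
  let ρ : MvPolynomial (Fin m) k →+* S := (algebraMap B S).comp (Ideal.Quotient.mk P)
  let J := idS f ρ
  have hfree : Module.Free S (MvPolynomial (Fin n) S ⧸ J) := hfree1
  have hφ : ∀ u : Fin m → L, (∀ p ∈ P, aeval u p = 0) → aeval u g1 ≠ 0 →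
      ∃ φ : S →+* L, φ.comp ρ = (aeval u : MvPolynomial (Fin m) k →ₐ[k] L).toRingHom := by
    intro u hu hug
    let φ0 : B →+* L := Ideal.Quotient.lift P (aeval u : MvPolynomial (Fin m) k →ₐ[k] L).toRingHom hu
    have hunit : IsUnit (φ0 g0) := by
      rw [← hg1]
      exact isUnit_iff_ne_zero.2 hug
    refine ⟨IsLocalization.Away.lift g0 hunit, ?_⟩
    rw [← RingHom.comp_assoc, IsLocalization.Away.lift_comp]
    rfl
  have hidl : ∀ (u : Fin m → L) (φ : S →+* L),
      φ.comp ρ = (aeval u : MvPolynomial (Fin m) k →ₐ[k] L).toRingHom →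
      specIdeal k L f u = J.map (MvPolynomial.map (σ := Fin n) φ) := by
    intro u φ hc
    rw [specIdeal_eq, ← hc, idS_map]
  -- finiteness
  have hJfin : Module.Finite S (MvPolynomial (Fin n) S ⧸ J) := by
    obtain ⟨u, hu, hug⟩ := nullst (L := L) P (g1 * h) (fun hc => (hPpr.mem_or_mem hc).elim hg1P hh)
    rw [map_mul] at hug
    obtain ⟨φ, hφu⟩ := hφ u hu (left_ne_zero_of_mul hug)
    have hf := hfin u hu (right_ne_zero_of_mul hug)
    rw [hidl u φ hφu] at hf
    letI := φ.toAlgebra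
    exact spec_finite (L := L) J hf
  let t : ℕ → MvPolynomial (Fin n) k := fun c => ∑ i : Fin n, C ((c : k) ^ (i : ℕ)) * X i
  have ht : ∀ (c : ℕ) (q : Fin n → L), aeval q (t c) = ∑ i : Fin n, (c : L) ^ (i : ℕ) * q i := by
    intro c q
    simp [t]
  let χ : ℕ → Polynomial S := fun c => LinearMap.charpoly (LinearMap.mulLeft S
    (Ideal.Quotient.mk J (MvPolynomial.map (ρ.comp C) (t c))))
  have hχmonic : ∀ c, (χ c).Monic := fun c => LinearMap.charpoly_monic _
  have hχspec : ∀ (u : Fin m → L) (φ : S →+* L),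
      φ.comp ρ = (aeval u : MvPolynomial (Fin m) k →ₐ[k] L).toRingHom →
      ∀ (_ : FiniteDimensional L (MvPolynomial (Fin n) L ⧸ specIdeal k L f u)) (c : ℕ),
      LinearMap.charpoly (LinearMap.mulLeft L ((Ideal.Quotient.mk (specIdeal k L f u))
        (MvPolynomial.map (algebraMap k L) (t c)))) = (χ c).map φ := by
    intro u φ hc hf c
    have hmap : MvPolynomial.map (algebraMap k L) (t c) =
        MvPolynomial.map φ (MvPolynomial.map (ρ.comp C) (t c)) := by
      have he : φ.comp (ρ.comp C) = algebraMap k L := by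
        rw [← RingHom.comp_assoc, hc]
        exact RingHom.ext fun r => by simp
      rw [MvPolynomial.map_map, he]
    rw [hmap]
    letI := φ.toAlgebra
    exact spec_charpoly J _ (hidl u φ hc) _ hf
  choose s d hs0 hsd using fun c => genGcd (χ c) (hχmonic c).ne_zero
  have hunitpow : ∀ w ∈ Submonoid.powers g0, IsUnit (algebraMap B S w) := fun w hw =>
    IsLocalization.map_units S (⟨w, hw⟩ : Submonoid.powers g0)
  have hlift : ∀ c, ∃ a : MvPolynomial (Fin m) k, ∃ v : S, IsUnit v ∧ ρ a = s c * v := by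
    intro c
    obtain ⟨⟨x, y⟩, hxy⟩ := IsLocalization.surj (Submonoid.powers g0) (s c)
    obtain ⟨a, ha⟩ := Ideal.Quotient.mk_surjective x
    refine ⟨a, algebraMap B S y, hunitpow y y.2, ?_⟩
    rw [hxy, ← ha]
    rfl
  choose a v hv hav using hlift
  have haP : ∀ c, a c ∉ P := by
    intro c hc
    have h0 : ρ (a c) = 0 := by
      change algebraMap B S (Ideal.Quotient.mk P (a c)) = 0
      rw [Ideal.Quotient.eq_zero_iff_mem.2 hc, map_zero]
    rw [hav] at h0
    exact mul_ne_zero (hs0 c) (hv c).ne_zero h0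
  have hdlift : ∀ c, ∃ D : Polynomial (MvPolynomial (Fin m) k), ∃ w : S, IsUnit w ∧
      D.map ρ = Polynomial.C w * d c := by
    intro c
    obtain ⟨w, hw, q, hq⟩ := clearDen (Submonoid.powers g0) S (fun _ : Unit => d c)
    obtain ⟨D, hD⟩ := Polynomial.map_surjective (Ideal.Quotient.mk P) Ideal.Quotient.mk_surjective (q ())
    refine ⟨D, algebraMap B S w, hunitpow w hw, ?_⟩
    rw [← hq (), ← hD, Polynomial.map_map]
  choose D w hw hDw using hdlift
  -- the degree count
  have hcount : ∀ (u : Fin m → L) (c : ℕ), (∀ p ∈ P, aeval u p = 0) → aeval u g1 ≠ 0 →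
      aeval u (a c) ≠ 0 →
      ∀ (_ : FiniteDimensional L (MvPolynomial (Fin n) L ⧸ specIdeal k L f u)),
      (d c).natDegree + ((fun q : Fin n → L => aeval q (t c)) ''
        {q | ∀ g ∈ specIdeal k L f u, aeval q g = 0}).ncard = (χ c).natDegree ∧
      IsGcdDer ((D c).map (aeval u).toRingHom) (LinearMap.charpoly (LinearMap.mulLeft L
      ((Ideal.Quotient.mk (specIdeal k L f u)) (MvPolynomial.map (algebraMap k L) (t c))))) := by
    intro u c hu hug hua hf
    obtain ⟨φ, hφu⟩ := hφ u hu hug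
    have hφs : φ (s c) ≠ 0 := by
      intro h0
      apply hua
      have : (aeval u : MvPolynomial (Fin m) k →ₐ[k] L).toRingHom (a c) = 0 := by
        rw [← hφu, RingHom.comp_apply, hav, map_mul, h0, zero_mul]
      exact this
    obtain ⟨hdeg, h1, h2, h3⟩ := hsd c L φ hφs
    have hroots := rootsCharpoly (specIdeal k L f u) (MvPolynomial.map (algebraMap k L) (t c))
    simp only [MvPolynomial.aeval_map_algebraMap] at hroots
    rw [← hroots, hχspec u φ hφu hf c]
    constructor
    · rw [← hdeg, rootsCount _ _ ((hχmonic c).map φ).ne_zero h1 h2 h3]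
      exact (hχmonic c).natDegree_map φ
    · have hu' : IsUnit (Polynomial.C (φ (w c))) := Polynomial.isUnit_C.2 ((hw c).map φ)
      have hDm : (D c).map (aeval u : MvPolynomial (Fin m) k →ₐ[k] L).toRingHom =
          Polynomial.C (φ (w c)) * (d c).map φ := by
        rw [← hφu, ← Polynomial.map_map, hDw, Polynomial.map_mul, Polynomial.map_C]
      rw [hDm]
      exact ⟨(hu'.mul_left_dvd).2 h1, (hu'.mul_left_dvd).2 h2,
        fun e he1 he2 => (h3 e he1 he2).mul_left _⟩
  let M := k₀ * k₀ * n + 1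
  have hGP : g1 * h * ∏ c ∈ Finset.range M, a c ∉ P := by
    intro hc
    rcases hPpr.mem_or_mem hc with hc | hc
    · exact (hPpr.mem_or_mem hc).elim hg1P hh
    · obtain ⟨c, -, hc⟩ := (hPpr.prod_mem_iff).1 hc
      exact haP c hc
  obtain ⟨u0, hu0, hu0g⟩ := nullst (L := L) P _ hGP
  rw [map_mul, map_mul, map_prod] at hu0g
  have hu0g1 := left_ne_zero_of_mul (left_ne_zero_of_mul hu0g)
  have hu0h := right_ne_zero_of_mul (left_ne_zero_of_mul hu0g)
  have hu0a := Finset.prod_ne_zero_iff.1 (right_ne_zero_of_mul hu0g)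
  have hf0 := hfin u0 hu0 hu0h
  have hc0 := hcard u0 hu0 hu0h
  rw [Nat.card_coe_set_eq] at hc0
  obtain ⟨c, hcM, hc⟩ : ∃ c : ℕ, c < M ∧
      Set.InjOn (fun q : Fin n → L => ∑ i : Fin n, (c : L) ^ (i : ℕ) * q i)
        {q | ∀ g ∈ specIdeal k L f u0, aeval q g = 0} := by
    obtain ⟨c, hc⟩ := sepForm _ (finVar (specIdeal k L f u0))
    refine ⟨c, ?_, hc⟩
    have h2 := c.2
    simp only [M]
    rw [← hc0]
    exact h2
  have hinj0 : Set.InjOn (fun q : Fin n → L => aeval q (t c))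
      {q | ∀ g ∈ specIdeal k L f u0, aeval q g = 0} := by
    simpa only [ht] using hc
  have hn0 := (hcount u0 c hu0 hu0g1 (hu0a c (Finset.mem_range.2 hcM)) hf0).1
  rw [Set.InjOn.ncard_image hinj0, hc0] at hn0
  refine ⟨g1 * a c, fun hc => (hPpr.mem_or_mem hc).elim hg1P (haP _), t c, D c, ?_⟩
  intro u hu hug huh hf
  rw [map_mul] at hug
  obtain ⟨hn, hgcd⟩ := hcount u c hu (left_ne_zero_of_mul hug) (right_ne_zero_of_mul hug) hf
  refine ⟨?_, hgcd⟩
  apply Set.injOn_of_ncard_image_eq ?_ (finVar (specIdeal k L f u))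
  have hcu := hcard u hu huh
  rw [Nat.card_coe_set_eq] at hcu
  rw [hcu]
  omega

theorem cover {k L : Type} [Field k] [CharZero k] [Field L] [Algebra k L] [IsAlgClosure k L]
    {m n l : ℕ} (f : Fin l → MvPolynomial (Fin m ⊕ Fin n) k)
    (E N : Finset (MvPolynomial (Fin m) k)) (k₀ : ℕ)
    (hfin : ∀ u : Fin m → L,
      (∀ g ∈ E, MvPolynomial.aeval u g = 0) → (∃ g ∈ N, MvPolynomial.aeval u g ≠ 0) →
      FiniteDimensional L (MvPolynomial (Fin n) L ⧸ specIdeal k L f u))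
    (hcard : ∀ u : Fin m → L,
      (∀ g ∈ E, MvPolynomial.aeval u g = 0) → (∃ g ∈ N, MvPolynomial.aeval u g ≠ 0) →
      Nat.card {p : Fin n → L | ∀ g ∈ specIdeal k L f u, MvPolynomial.aeval p g = 0} = k₀)
    (I : Ideal (MvPolynomial (Fin m) k)) :
    ∃ ls : List (Finset (MvPolynomial (Fin m) k) × Finset (MvPolynomial (Fin m) k) ×
        MvPolynomial (Fin n) k × Polynomial (MvPolynomial (Fin m) k)),
      (∀ u : Fin m → L, ((∀ g ∈ I, aeval u g = 0) ∧ (∀ g ∈ E, aeval u g = 0) ∧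
          (∃ g ∈ N, aeval u g ≠ 0)) ↔
        ∃ x ∈ ls, (∀ g ∈ x.1, aeval u g = 0) ∧ (∃ g ∈ x.2.1, aeval u g ≠ 0)) ∧
      ∀ x ∈ ls, ∀ u : Fin m → L, (∀ g ∈ x.1, aeval u g = 0) → (∃ g ∈ x.2.1, aeval u g ≠ 0) →
        Good k L f x.2.2.1 x.2.2.2 u := by
  classical
  induction I using WellFoundedGT.induction with
  | _ I ih =>
  have hadd : ∀ (u : Fin m → L) (a : MvPolynomial (Fin m) k),
      (∀ g ∈ I ⊔ Ideal.span {a}, aeval u g = 0) ↔ (∀ g ∈ I, aeval u g = 0) ∧ aeval u a = 0 := by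
    intro u a
    constructor
    · intro h
      exact ⟨fun g hg => h g (Ideal.mem_sup_left hg),
        h a (Ideal.mem_sup_right (Ideal.mem_span_singleton_self a))⟩
    · rintro ⟨h1, h2⟩ g hg
      obtain ⟨x, hx, y, hy, rfl⟩ := Submodule.mem_sup.1 hg
      obtain ⟨c, rfl⟩ := Ideal.mem_span_singleton'.1 hy
      rw [map_add, h1 x hx, map_mul, h2, mul_zero, zero_add]
  have hlt : ∀ a, a ∉ I → I < I ⊔ Ideal.span {a} := by
    intro a ha
    refine lt_of_le_of_ne le_sup_left fun h => ha ?_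
    rw [h]
    exact Ideal.mem_sup_right (Ideal.mem_span_singleton_self a)
  by_cases hE : ∃ e ∈ E, e ∉ I
  · obtain ⟨e, heE, heI⟩ := hE
    obtain ⟨ls, h1, h2⟩ := ih _ (hlt e heI)
    refine ⟨ls, fun u => ?_, h2⟩
    rw [← h1 u, hadd]
    constructor
    · rintro ⟨p, q, r⟩; exact ⟨⟨p, q e heE⟩, q, r⟩
    · rintro ⟨⟨p, _⟩, q, r⟩; exact ⟨p, q, r⟩
  push Not at hE
  by_cases hN : ∃ h ∈ N, h ∉ I
  swap
  · push Not at hN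
    refine ⟨[], fun u => ?_, by simp⟩
    simp only [List.not_mem_nil, false_and, exists_false, iff_false]
    rintro ⟨p, -, g, hg, hg0⟩
    exact hg0 (p g (hN g hg))
  obtain ⟨h, hhN, hhI⟩ := hN
  by_cases hI : I.IsPrime
  · obtain ⟨g, hgI, t, d, hgood⟩ := key f k₀ I h hhI
      (fun u hu hu' => hfin u (fun g hg => hu g (hE g hg)) ⟨h, hhN, hu'⟩)
      (fun u hu hu' => hcard u (fun g hg => hu g (hE g hg)) ⟨h, hhN, hu'⟩)
    have hghI : g * h ∉ I := fun hc => (hI.mem_or_mem hc).elim hgI hhI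
    obtain ⟨ls, h1, h2⟩ := ih _ (hlt _ hghI)
    obtain ⟨G, hG⟩ := (isNoetherian_def.1 (inferInstance : IsNoetherian (MvPolynomial (Fin m) k) (MvPolynomial (Fin m) k))) I
    have hGu : ∀ u : Fin m → L, (∀ g ∈ G, aeval u g = 0) ↔ ∀ g ∈ I, aeval u g = 0 := by
      intro u
      constructor
      · intro hu
        have : I ≤ RingHom.ker (aeval u : MvPolynomial (Fin m) k →ₐ[k] L) := by
          rw [← hG]
          exact Submodule.span_le.2 hu
        exact fun g hg => this hg
      · intro hu g hg
        exact hu g (hG ▸ Submodule.subset_span hg)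
    refine ⟨(G, {g * h}, t, d) :: ls, fun u => ?_, ?_⟩
    · simp only [List.mem_cons, exists_eq_or_imp, hGu, Finset.mem_singleton, exists_eq_left]
      rw [← h1 u, hadd]
      constructor
      · rintro ⟨p, q, r⟩
        by_cases h0 : aeval u (g * h) = 0
        · exact Or.inr ⟨⟨p, h0⟩, q, r⟩
        · exact Or.inl ⟨p, h0⟩
      · rintro (⟨p, q⟩ | ⟨⟨p, _⟩, q, r⟩)
        · rw [map_mul] at q
          exact ⟨p, fun e he => p e (hE e he), h, hhN, right_ne_zero_of_mul q⟩
        · exact ⟨p, q, r⟩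
    · intro x hx u hx1 hx2
      rcases List.mem_cons.1 hx with rfl | hx
      · simp only [hGu, Finset.mem_singleton, exists_eq_left, map_mul] at hx1 hx2
        exact hgood u hx1 (left_ne_zero_of_mul hx2) (right_ne_zero_of_mul hx2)
      · exact h2 x hx u hx1 hx2
  · have hne : I ≠ ⊤ := fun h0 => hhI (h0 ▸ Submodule.mem_top)
    obtain ⟨a, ha, b, hb, hab⟩ := (Ideal.not_isPrime_iff.1 hI).resolve_left hne
    obtain ⟨ls, h1, h2⟩ := ih _ (hlt a ha)
    obtain ⟨ls', h1', h2'⟩ := ih _ (hlt b hb)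
    refine ⟨ls ++ ls', fun u => ?_, ?_⟩
    · simp only [List.mem_append, or_and_right, exists_or]
      rw [← h1 u, ← h1' u, hadd, hadd]
      constructor
      · rintro ⟨p, q⟩
        have := p _ hab
        rw [map_mul, mul_eq_zero] at this
        exact this.imp (fun z => ⟨⟨p, z⟩, q⟩) (fun z => ⟨⟨p, z⟩, q⟩)
      · rintro (⟨⟨p, _⟩, q⟩ | ⟨⟨p, _⟩, q⟩) <;> exact ⟨p, q⟩
    · intro x hx
      rcases List.mem_append.1 hx with hx | hx
      · exact h2 x hx
      · exact h2' x hx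

end Stmt14Aux

/-- joint choice of separating elements and parametric GCDs: if on
`V_L(E)∖V_L(N)` every `I(u)` is zero-dimensional with exactly `k₀` points, then
`V_L(E)∖V_L(N)` can be covered by finitely many branches `V_L(E_i)∖V_L(N_i)` carrying
`t_i ∈ k[X]` and `d_i ∈ k[U][T]` such that on each branch `t_i` separates `V_L(I(u))` and
`d_i(u,T)` is a gcd in `L[T]` of the characteristic polynomial `χ_i(u)` of multiplication
by `t_i` on `L[X]/I(u)` and its derivative. -/
theorem stmt_14 (k L : Type) [Field k] [CharZero k] [Field L] [Algebra k L]
    [IsAlgClosure k L] (m n l : ℕ) (f : Fin l → MvPolynomial (Fin m ⊕ Fin n) k)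
    (E N : Finset (MvPolynomial (Fin m) k)) (k₀ : ℕ)
    (hfin : ∀ u : Fin m → L,
      (∀ g ∈ E, MvPolynomial.aeval u g = 0) → (∃ g ∈ N, MvPolynomial.aeval u g ≠ 0) →
      FiniteDimensional L (MvPolynomial (Fin n) L ⧸ specIdeal k L f u))
    (hcard : ∀ u : Fin m → L,
      (∀ g ∈ E, MvPolynomial.aeval u g = 0) → (∃ g ∈ N, MvPolynomial.aeval u g ≠ 0) →
      Nat.card {p : Fin n → L | ∀ g ∈ specIdeal k L f u, MvPolynomial.aeval p g = 0} = k₀) :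
    ∃ (s : ℕ) (Es Ns : Fin s → Finset (MvPolynomial (Fin m) k))
      (ts : Fin s → MvPolynomial (Fin n) k)
      (ds : Fin s → Polynomial (MvPolynomial (Fin m) k)),
      (∀ u : Fin m → L,
        ((∀ g ∈ E, MvPolynomial.aeval u g = 0) ∧ (∃ g ∈ N, MvPolynomial.aeval u g ≠ 0))
          ↔ ∃ i : Fin s, (∀ g ∈ Es i, MvPolynomial.aeval u g = 0) ∧
              (∃ g ∈ Ns i, MvPolynomial.aeval u g ≠ 0)) ∧
      (∀ (i : Fin s) (u : Fin m → L)
        (hE : ∀ g ∈ Es i, MvPolynomial.aeval u g = 0)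
        (hN : ∃ g ∈ Ns i, MvPolynomial.aeval u g ≠ 0),
        -- these branch conditions put `u` in `V_L(E)∖V_L(N)`, so `I(u)` is zero-dimensional
        ∀ hu : (∀ g ∈ E, MvPolynomial.aeval u g = 0) ∧ (∃ g ∈ N, MvPolynomial.aeval u g ≠ 0),
        Set.InjOn (fun q : Fin n → L => MvPolynomial.aeval q (ts i))
            {q : Fin n → L | ∀ g ∈ specIdeal k L f u, MvPolynomial.aeval q g = 0} ∧
          (letI := hfin u hu.1 hu.2
           let χ : Polynomial L := LinearMap.charpoly (LinearMap.mulLeft L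
              ((Ideal.Quotient.mk (specIdeal k L f u)) (MvPolynomial.map (algebraMap k L) (ts i))))
           let dspec : Polynomial L := (ds i).map (MvPolynomial.aeval u).toRingHom
           dspec ∣ χ ∧ dspec ∣ Polynomial.derivative χ ∧
             ∀ e : Polynomial L, e ∣ χ → e ∣ Polynomial.derivative χ → e ∣ dspec)) := by
  obtain ⟨ls, h1, h2⟩ := Stmt14Aux.cover f E N k₀ hfin hcard ⊥
  refine ⟨ls.length, fun i => (ls.get i).1, fun i => (ls.get i).2.1, fun i => (ls.get i).2.2.1,
    fun i => (ls.get i).2.2.2, fun u => ?_, fun i u hE hN hu => ?_⟩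
  · have h0 : ∀ g ∈ (⊥ : Ideal (MvPolynomial (Fin m) k)), MvPolynomial.aeval u g = 0 := by
      intro g hg
      rw [Ideal.mem_bot.1 hg, map_zero]
    have h3 := h1 u
    constructor
    · intro h
      obtain ⟨x, hx, hx'⟩ := h3.1 ⟨h0, h⟩
      obtain ⟨i, rfl⟩ := List.mem_iff_get.1 hx
      exact ⟨i, hx'⟩
    · rintro ⟨i, hi⟩
      exact (h3.2 ⟨_, List.get_mem ls i, hi⟩).2
  · exact h2 _ (List.get_mem ls i) u hE hN (hfin u hu.1 hu.2)
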